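/- Let R be a Noetherian commutative ring, let M and N be finitely generated R-modules, and let W be a multiplicatively closed subset of R. If W^{-1}M is isomorphic to W^{-1}N as W^{-1}R-modules, then there exists u ∈ W such that M_u is isomorphic to N_u as R_u-modules, where M_u, N_u, R_u denote the localizations at the multiplicative set {1, u, u², …}. -/

import Mathlib

universe u

theorem statement17 (R : Type u) [CommRing R] [IsNoetherianRing R]
    (M N : Type u) [AddCommGroup M] [Module R M] [AddCommGroup N] [Module R N]
    [Module.Finite R M] [Module.Finite R N] (W : Submonoid R)
    (h : Nonempty ((LocalizedModule W M) ≃ₗ[Localization W] (LocalizedModule W N))) :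
    ∃ u ∈ W, Nonempty
      ((LocalizedModule (Submonoid.powers u) M) ≃ₗ[Localization (Submonoid.powers u)]
        (LocalizedModule (Submonoid.powers u) N)) := by
  obtain ⟨e⟩ := h
  have := Module.finitePresentation_of_finite R M
  have := Module.finitePresentation_of_finite R N
  obtain ⟨u, hu, e', -⟩ := Module.FinitePresentation.exists_lift_equiv_of_isLocalizedModule W
    (LocalizedModule.mkLinearMap W M) (LocalizedModule.mkLinearMap W N) (e.restrictScalars R)
  exact ⟨u, hu, ⟨e'⟩⟩
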